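/- On ℝ² with coordinates (x¹, x²) consider the conformally flat metric g_{ab} = σ²δ_{ab}, where σ : ℝ² → ℝ is smooth and positive. Let V : ℝ → ℝ be smooth, let f : ℝ² → ℝ be smooth, and define the symmetric tensor field T_{ab} := ∂_a f ∂_b f − ((1/2)σ^{−2}((∂₁f)² + (∂₂f)²) + V(f))·σ²δ_{ab}. If f satisfies the scalar field equation ∂₁²f + ∂₂²f = σ²·V'(f), then the covariant divergence of T with respect to the Levi-Civita connection of g vanishes: ∇_b T_a^{ b} = 0 for a = 1,2. -/

import Mathlib

open Matrix

noncomputable section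

abbrev V2 := Fin 2 → ℝ

/-- Partial derivative `∂ₐ f` on `ℝ²`. -/
def pd2 (a : Fin 2) (f : V2 → ℝ) (x : V2) : ℝ := fderiv ℝ f x (Pi.single a 1)

theorem pd2_mul (a : Fin 2) {u v : V2 → ℝ} {x : V2} (hu : DifferentiableAt ℝ u x)
    (hv : DifferentiableAt ℝ v x) :
    pd2 a (fun y => u y * v y) x = pd2 a u x * v x + u x * pd2 a v x := by
  unfold pd2
  rw [fderiv_fun_mul hu hv]
  simp
  ring

theorem pd2_sub (a : Fin 2) {u v : V2 → ℝ} {x : V2} (hu : DifferentiableAt ℝ u x)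
    (hv : DifferentiableAt ℝ v x) :
    pd2 a (fun y => u y - v y) x = pd2 a u x - pd2 a v x := by
  unfold pd2
  rw [fderiv_fun_sub hu hv]
  simp

theorem pd2_add (a : Fin 2) {u v : V2 → ℝ} {x : V2} (hu : DifferentiableAt ℝ u x)
    (hv : DifferentiableAt ℝ v x) :
    pd2 a (fun y => u y + v y) x = pd2 a u x + pd2 a v x := by
  unfold pd2
  rw [fderiv_fun_add hu hv]
  simp

theorem pd2_const (a : Fin 2) (c : ℝ) (x : V2) : pd2 a (fun _ => c) x = 0 := by
  simp [pd2]

theorem pd2_comp (a : Fin 2) {V : ℝ → ℝ} {f : V2 → ℝ} {x : V2} (hV : DifferentiableAt ℝ V (f x))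
    (hf : DifferentiableAt ℝ f x) :
    pd2 a (fun y => V (f y)) x = deriv V (f x) * pd2 a f x := by
  unfold pd2
  have h := (hV.hasDerivAt.comp_hasFDerivAt x hf.hasFDerivAt).fderiv
  have h2 : (fun y => V (f y)) = V ∘ f := rfl
  rw [h2, h]
  simp

theorem pd2_contDiff (a : Fin 2) {f : V2 → ℝ} (hf : ContDiff ℝ (⊤ : ℕ∞) f) :
    ContDiff ℝ (⊤ : ℕ∞) (pd2 a f) := by
  unfold pd2
  exact (hf.fderiv_right (m := (⊤ : ℕ∞)) (by simp)).clm_apply contDiff_const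

theorem pd2_eq_snd {f : V2 → ℝ} (hf : ContDiff ℝ (⊤ : ℕ∞) f) (a b : Fin 2) (x : V2) :
    pd2 a (pd2 b f) x = fderiv ℝ (fderiv ℝ f) x (Pi.single a 1) (Pi.single b 1) := by
  have h : DifferentiableAt ℝ (fderiv ℝ f) x :=
    (hf.fderiv_right (m := (⊤ : ℕ∞)) (by simp)).differentiable (by simp) x
  have h2 : pd2 b f = fun y => fderiv ℝ f y (Pi.single b 1) := rfl
  rw [h2]
  unfold pd2
  rw [fderiv_clm_apply h (differentiableAt_const _)]
  simp

theorem pd2_comm {f : V2 → ℝ} (hf : ContDiff ℝ (⊤ : ℕ∞) f) (a b : Fin 2) (x : V2) :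
    pd2 a (pd2 b f) x = pd2 b (pd2 a f) x := by
  rw [pd2_eq_snd hf, pd2_eq_snd hf]
  have h : IsSymmSndFDerivAt ℝ f x :=
    hf.contDiffAt.isSymmSndFDerivAt (by
      simp only [minSmoothness_of_isRCLikeNormedField]
      exact WithTop.coe_le_coe.2 (le_top : (2 : ℕ∞) ≤ ⊤))
  exact h _ _

/-- **Scalar-field solutions (28m)–(28u) of equation (27b)**: on `ℝ²` with the conformally
flat metric `g_{ab} = σ² δ_{ab}`, the tensor
`T_{ab} = ∂ₐf ∂_b f - ((1/2)σ⁻²|∂f|² + V(f)) σ² δ_{ab}` has vanishing covariant divergence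
`∇_b T_a^{ b} = |g|⁻¹ ∂_b(|g| T_a^{ b}) - (1/2) T^{bc} ∂ₐ g_{bc}` provided `f` satisfies the
scalar field equation `f_{,11} + f_{,22} = σ² V'(f)`. -/
theorem scalar_field_tensor_divergence_free
    (σ : V2 → ℝ) (hσ : ContDiff ℝ (⊤ : ℕ∞) σ) (hσpos : ∀ x, 0 < σ x)
    (V : ℝ → ℝ) (hV : ContDiff ℝ (⊤ : ℕ∞) V)
    (f : V2 → ℝ) (hf : ContDiff ℝ (⊤ : ℕ∞) f)
    (hfield : ∀ x, pd2 0 (fun y => pd2 0 f y) x + pd2 1 (fun y => pd2 1 f y) x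
        = σ x ^ 2 * deriv V (f x)) :
    -- the metric g_{ab} = σ² δ_{ab}
    let g : V2 → Matrix (Fin 2) (Fin 2) ℝ := fun x =>
      Matrix.of fun a b => σ x ^ 2 * (if a = b then (1 : ℝ) else 0)
    -- the tensor T_{ab}
    let T : V2 → Matrix (Fin 2) (Fin 2) ℝ := fun x =>
      Matrix.of fun a b =>
        pd2 a f x * pd2 b f x -
          ((1 / 2) * (σ x ^ 2)⁻¹ * ((pd2 0 f x) ^ 2 + (pd2 1 f x) ^ 2) + V (f x)) *
            (σ x ^ 2 * (if a = b then (1 : ℝ) else 0))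
    -- the mixed tensor T_a^{ b} = g^{bc} T_{ac}
    let Tmix : V2 → Matrix (Fin 2) (Fin 2) ℝ := fun x =>
      Matrix.of fun a b => ∑ c, (g x)⁻¹ b c * T x a c
    -- the contravariant tensor T^{bc} = g^{bd} g^{ce} T_{de}
    let Tup : V2 → Matrix (Fin 2) (Fin 2) ℝ := fun x =>
      Matrix.of fun b c => ∑ d, ∑ e, (g x)⁻¹ b d * (g x)⁻¹ c e * T x d e
    -- vanishing of the covariant divergence ∇_b T_a^{ b}
    ∀ a : Fin 2, ∀ x : V2,
      (Real.sqrt (g x).det)⁻¹ *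
          (∑ b, pd2 b (fun y => Real.sqrt (g y).det * Tmix y a b) x) -
        (1 / 2) * (∑ b, ∑ c, Tup x b c * pd2 a (fun y => g y b c) x) = 0 := by
  intro g T Tmix Tup a x
  have hne : ∀ y, σ y ≠ 0 := fun y => (hσpos y).ne'
  have hsq : ∀ y, Real.sqrt (g y).det = σ y ^ 2 := by
    intro y
    have h : (g y).det = (σ y ^ 2) ^ 2 := by
      simp [g, Matrix.det_fin_two]
      ring
    rw [h, Real.sqrt_sq (by positivity)]
  have hinv : ∀ y, (g y)⁻¹ = Matrix.of fun a b => (σ y ^ 2)⁻¹ * (if a = b then (1 : ℝ) else 0) := by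
    intro y
    apply Matrix.inv_eq_right_inv
    have := hne y
    ext i j
    fin_cases i <;> fin_cases j <;> simp [g, Matrix.mul_apply, this]
  have hT : ∀ a b, (fun y => Real.sqrt (g y).det * Tmix y a b) = fun y =>
      pd2 a f y * pd2 b f y -
        ((1 / 2) * (pd2 0 f y * pd2 0 f y + pd2 1 f y * pd2 1 f y) + V (f y) * (σ y * σ y)) *
          (if a = b then (1 : ℝ) else 0) := by
    intro a b
    funext y
    have := hne y
    rw [hsq]
    simp only [Tmix, hinv, T, Matrix.of_apply, Fin.sum_univ_two]
    fin_cases a <;> fin_cases b <;> simp <;> field_simp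
  have hg : ∀ b c, (fun y => g y b c) = fun y => (σ y * σ y) * (if b = c then (1 : ℝ) else 0) := by
    intro b c
    funext y
    simp [g, pow_two]
  have dσ : DifferentiableAt ℝ σ x := hσ.differentiable (by simp) x
  have df : DifferentiableAt ℝ f x := hf.differentiable (by simp) x
  have dV : DifferentiableAt ℝ V (f x) := hV.differentiable (by simp) (f x)
  have dVf : DifferentiableAt ℝ (fun y => V (f y)) x := dV.comp x df
  have dp : ∀ a, DifferentiableAt ℝ (pd2 a f) x := fun a =>
    (pd2_contDiff a hf).differentiable (by simp) x
  have dσσ := dσ.fun_mul dσ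
  have dpp : ∀ a b, DifferentiableAt ℝ (fun y => pd2 a f y * pd2 b f y) x := fun a b =>
    (dp a).fun_mul (dp b)
  have dq := (dpp 0 0).fun_add (dpp 1 1)
  have dq2 := dq.const_mul (1 / 2 : ℝ)
  have dVs := dVf.fun_mul dσσ
  have dall := dq2.fun_add dVs
  have hfinal : ∀ a b, pd2 b (fun y => Real.sqrt (g y).det * Tmix y a b) x =
      pd2 b (pd2 a f) x * pd2 b f x + pd2 a f x * pd2 b (pd2 b f) x -
      (pd2 0 f x * pd2 b (pd2 0 f) x + pd2 1 f x * pd2 b (pd2 1 f) x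
        + deriv V (f x) * pd2 b f x * σ x ^ 2 + V (f x) * (2 * σ x * pd2 b σ x)) *
          (if a = b then (1 : ℝ) else 0) := by
    intro a b
    rw [hT, pd2_sub b (dpp a b) (dall.mul_const _), pd2_mul b dall (differentiableAt_const _),
      pd2_add b dq2 dVs, pd2_mul b (differentiableAt_const _) dq, pd2_add b (dpp 0 0) (dpp 1 1),
      pd2_mul b (dp a) (dp b), pd2_mul b (dp 0) (dp 0), pd2_mul b (dp 1) (dp 1),
      pd2_mul b dVf dσσ, pd2_mul b dσ dσ, pd2_comp b dV df, pd2_const, pd2_const]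
    ring
  have hgd : ∀ b c, pd2 a (fun y => g y b c) x =
      2 * σ x * pd2 a σ x * (if b = c then (1 : ℝ) else 0) := by
    intro b c
    rw [hg, pd2_mul a dσσ (differentiableAt_const _), pd2_mul a dσ dσ, pd2_const]
    ring
  have hF : pd2 0 (pd2 0 f) x + pd2 1 (pd2 1 f) x = σ x ^ 2 * deriv V (f x) := hfield x
  have hF' : pd2 0 (pd2 0 f) x = σ x ^ 2 * deriv V (f x) - pd2 1 (pd2 1 f) x := by linarith
  have hc := pd2_comm hf 0 1 x
  have := hne x
  simp only [Fin.sum_univ_two, hfinal, hgd]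
  simp only [hsq, Tup, hinv, T, Matrix.of_apply, Fin.sum_univ_two]
  fin_cases a <;> simp [hF', hc] <;> field_simp <;> ring
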